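/- Let k be a field, S = k[s,t]/(s^2,t^2), and Π_k(S) the generalized preprojective algebra: the quotient of the free algebra k⟨a,s,t,e,f⟩ (with a,s,t in degree 0 and e,f in degree 1) by the relations s^2 = t^2 = st − ts = 0, a^2 = a, as = sa = at = ta = 0, ea = e, af = f, ae = fa = 0, es = et = sf = tf = 0, fe = 0, and efst + seft + tefs + stef = 0. Then dim_k Π_k(S)_d ≤ 5(d+1) for d even and dim_k Π_k(S)_d ≤ 4(d+1) for d odd. -/

import Mathlib

set_option synthInstance.maxHeartbeats 1000000
set_option maxHeartbeats 1000000

noncomputable section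

/-- Generators `a, s, t, e, f` of the generalized preprojective algebra
`Π_k(k[s,t]/(s²,t²))`. -/
inductive Gen5 : Type
  | a | s | t | e | f
deriving DecidableEq

variable (k : Type) [Field k]

/-- The image of a generator in the free algebra. -/
def g5 (x : Gen5) : FreeAlgebra k Gen5 := FreeAlgebra.ι k x

open Gen5 in
/-- The defining relations of `Π_k(k[s,t]/(s²,t²))`:
`s² = t² = st − ts = 0`, `a² = a`, `as = sa = at = ta = 0`, `ea = e`, `af = f`,
`ae = fa = 0`, `es = et = sf = tf = 0`, `fe = 0`, and
`efst + seft + tefs + stef = 0`. -/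
inductive Rel5 : FreeAlgebra k Gen5 → FreeAlgebra k Gen5 → Prop
  | ss : Rel5 (g5 k s * g5 k s) 0
  | tt : Rel5 (g5 k t * g5 k t) 0
  | st : Rel5 (g5 k s * g5 k t) (g5 k t * g5 k s)
  | aa : Rel5 (g5 k a * g5 k a) (g5 k a)
  | as : Rel5 (g5 k a * g5 k s) 0
  | sa : Rel5 (g5 k s * g5 k a) 0
  | at : Rel5 (g5 k a * g5 k t) 0
  | ta : Rel5 (g5 k t * g5 k a) 0
  | ea : Rel5 (g5 k e * g5 k a) (g5 k e)
  | af : Rel5 (g5 k a * g5 k f) (g5 k f)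
  | ae : Rel5 (g5 k a * g5 k e) 0
  | fa : Rel5 (g5 k f * g5 k a) 0
  | es : Rel5 (g5 k e * g5 k s) 0
  | et : Rel5 (g5 k e * g5 k t) 0
  | sf : Rel5 (g5 k s * g5 k f) 0
  | tf : Rel5 (g5 k t * g5 k f) 0
  | fe : Rel5 (g5 k f * g5 k e) 0
  | pre : Rel5 (g5 k e * g5 k f * g5 k s * g5 k t + g5 k s * g5 k e * g5 k f * g5 k t +
      g5 k t * g5 k e * g5 k f * g5 k s + g5 k s * g5 k t * g5 k e * g5 k f) 0

/-- The generalized preprojective algebra `Π_k(k[s,t]/(s²,t²))`. -/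
def Pi5 := RingQuot (Rel5 k)

instance : Ring (Pi5 k) := by unfold Pi5; infer_instance
instance : Algebra k (Pi5 k) := by unfold Pi5; infer_instance

/-- Degrees: `a, s, t` have degree `0`, `e, f` degree `1`. -/
def deg5 : Gen5 → ℕ
  | .a | .s | .t => 0
  | .e | .f => 1

/-- The degree-`d` component of `Π_k(k[s,t]/(s²,t²))`: the `k`-span of (images of) words
with `d` occurrences of `e, f` in total. -/
def Pi5Comp (d : ℕ) : Submodule k (Pi5 k) :=
  Submodule.span k
    {z | ∃ l : List Gen5, (l.map deg5).sum = d ∧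
      z = (l.map fun x => RingQuot.mkAlgHom k (Rel5 k) (g5 k x)).prod}

namespace Pi5

open Submodule

/-- The quotient map from the free algebra to `Π_k(S)`. -/
def proj : FreeAlgebra k Gen5 →ₐ[k] Pi5 k := RingQuot.mkAlgHom k (Rel5 k)

/-- The image of a generator in `Π_k(S)`. -/
def gen (x : Gen5) : Pi5 k := proj k (g5 k x)

theorem proj_g5 (x : Gen5) : proj k (g5 k x) = gen k x := rfl

variable {k} in
theorem proj_eq {x y : FreeAlgebra k Gen5} (h : Rel5 k x y) : proj k x = proj k y :=
  RingQuot.mkAlgHom_rel k h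

/-! ### The defining relations in `Π_k(S)` -/

theorem gen_ss : gen k .s * gen k .s = 0 := by
  simpa [proj_g5] using proj_eq (Rel5.ss (k := k))
theorem gen_tt : gen k .t * gen k .t = 0 := by
  simpa [proj_g5] using proj_eq (Rel5.tt (k := k))
theorem gen_ts : gen k .t * gen k .s = gen k .s * gen k .t := by
  simpa [proj_g5] using (proj_eq (Rel5.st (k := k))).symm
theorem gen_aa : gen k .a * gen k .a = gen k .a := by
  simpa [proj_g5] using proj_eq (Rel5.aa (k := k))
theorem gen_as : gen k .a * gen k .s = 0 := by
  simpa [proj_g5] using proj_eq (Rel5.as (k := k))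
theorem gen_sa : gen k .s * gen k .a = 0 := by
  simpa [proj_g5] using proj_eq (Rel5.sa (k := k))
theorem gen_at : gen k .a * gen k .t = 0 := by
  simpa [proj_g5] using proj_eq (Rel5.at (k := k))
theorem gen_ta : gen k .t * gen k .a = 0 := by
  simpa [proj_g5] using proj_eq (Rel5.ta (k := k))
theorem gen_ea : gen k .e * gen k .a = gen k .e := by
  simpa [proj_g5] using proj_eq (Rel5.ea (k := k))
theorem gen_af : gen k .a * gen k .f = gen k .f := by
  simpa [proj_g5] using proj_eq (Rel5.af (k := k))
theorem gen_ae : gen k .a * gen k .e = 0 := by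
  simpa [proj_g5] using proj_eq (Rel5.ae (k := k))
theorem gen_fa : gen k .f * gen k .a = 0 := by
  simpa [proj_g5] using proj_eq (Rel5.fa (k := k))
theorem gen_fe : gen k .f * gen k .e = 0 := by
  simpa [proj_g5] using proj_eq (Rel5.fe (k := k))

theorem gen_ss_assoc (z : Pi5 k) : gen k .s * (gen k .s * z) = 0 := by
  rw [← mul_assoc, gen_ss, zero_mul]
theorem gen_tt_assoc (z : Pi5 k) : gen k .t * (gen k .t * z) = 0 := by
  rw [← mul_assoc, gen_tt, zero_mul]
theorem gen_ts_assoc (z : Pi5 k) :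
    gen k .t * (gen k .s * z) = gen k .s * (gen k .t * z) := by
  rw [← mul_assoc, gen_ts, mul_assoc]
theorem gen_fe_assoc (z : Pi5 k) : gen k .f * (gen k .e * z) = 0 := by
  rw [← mul_assoc, gen_fe, zero_mul]

theorem preprojective : gen k .e * (gen k .f * (gen k .s * gen k .t))
    + gen k .s * (gen k .e * (gen k .f * gen k .t))
    + gen k .t * (gen k .e * (gen k .f * gen k .s))
    + gen k .s * (gen k .t * (gen k .e * gen k .f)) = 0 := by
  simpa [proj_g5, mul_assoc] using proj_eq (Rel5.pre (k := k))

theorem sandwich_preprojective (x y : Pi5 k) :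
    x * (gen k .e * (gen k .f * (gen k .s * (gen k .t * y))))
    + x * (gen k .s * (gen k .e * (gen k .f * (gen k .t * y))))
    + x * (gen k .t * (gen k .e * (gen k .f * (gen k .s * y))))
    + x * (gen k .s * (gen k .t * (gen k .e * (gen k .f * y)))) = 0 := by
  simpa [mul_add, add_mul, mul_assoc] using congrArg (fun z => x * z * y) (preprojective k)

/-! ### Submodules spanned by single words -/

/-- The line spanned by a generator. -/
def line (x : Gen5) : Submodule k (Pi5 k) := k ∙ gen k x

/-- The span of `fse`. -/
def P : Submodule k (Pi5 k) := line k .f * line k .s * line k .e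

/-- The span of `fte`. -/
def Q : Submodule k (Pi5 k) := line k .f * line k .t * line k .e

/-- The span of `fste`. -/
def R : Submodule k (Pi5 k) := line k .f * line k .s * line k .t * line k .e

/-- The span of `fse` and `fte`. -/
def N : Submodule k (Pi5 k) := P k ⊔ Q k

/-- The image of `S = k[s,t]/(s²,t²)`. -/
def S : Submodule k (Pi5 k) :=
  1 ⊔ line k .s ⊔ line k .t ⊔ line k .s * line k .t

theorem span_singleton_mul_span_singleton (x y : Pi5 k) : (k ∙ x) * (k ∙ y) = k ∙ (x * y) := by
  rw [span_mul_span, Set.singleton_mul_singleton]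

theorem one_eq_span_singleton : (1 : Submodule k (Pi5 k)) = k ∙ 1 := Submodule.one_eq_span

variable {k} in
theorem span_singleton_le_of_eq_neg {x y : Pi5 k} (h : x = -y) : (k ∙ x) ≤ k ∙ y := by
  rw [h, span_singleton_le_iff_mem]
  exact (k ∙ y).neg_mem (mem_span_singleton_self _)

theorem Q_mul_P : Q k * P k = P k * Q k := by
  have h := sandwich_preprojective k (gen k .f) (gen k .e)
  simp only [gen_fe, gen_fe_assoc, mul_zero, zero_add, add_zero] at h
  simp only [P, Q, line, span_singleton_mul_span_singleton, mul_assoc]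
  exact le_antisymm (span_singleton_le_of_eq_neg (by rw [eq_neg_iff_add_eq_zero, add_comm, h]))
    (span_singleton_le_of_eq_neg (by rw [eq_neg_iff_add_eq_zero, h]))

theorem P_mul_R : P k * R k = R k * P k := by
  have h := sandwich_preprojective k (gen k .f * gen k .s) (gen k .e)
  simp only [gen_fe, gen_ss_assoc, mul_zero, add_zero, mul_assoc] at h
  simp only [P, R, line, span_singleton_mul_span_singleton, mul_assoc]
  exact le_antisymm (span_singleton_le_of_eq_neg (by rw [eq_neg_iff_add_eq_zero, h]))
    (span_singleton_le_of_eq_neg (by rw [eq_neg_iff_add_eq_zero, add_comm, h]))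

theorem Q_mul_R : Q k * R k = R k * Q k := by
  have h := sandwich_preprojective k (gen k .f * gen k .t) (gen k .e)
  simp only [gen_fe, gen_tt_assoc, gen_ts_assoc, mul_zero, add_zero, mul_assoc] at h
  simp only [Q, R, line, span_singleton_mul_span_singleton, mul_assoc]
  exact le_antisymm (span_singleton_le_of_eq_neg (by rw [eq_neg_iff_add_eq_zero, h]))
    (span_singleton_le_of_eq_neg (by rw [eq_neg_iff_add_eq_zero, add_comm, h]))

theorem commute_N_R : Commute (N k) (R k) := by
  simp only [Commute, SemiconjBy, N, Submodule.sup_mul, Submodule.mul_sup, P_mul_R, Q_mul_R]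

variable {k} in
theorem span_singleton_le_sup_of_add_eq_zero {x y z : Pi5 k} (h : x + y + z = 0) :
    (k ∙ x) ≤ (k ∙ y) ⊔ (k ∙ z) := by
  rw [span_singleton_le_iff_mem, show x = -y + -z by
    rw [← sub_eq_zero, ← h]; abel]
  exact add_mem (mem_sup_left ((k ∙ y).neg_mem (mem_span_singleton_self _)))
    (mem_sup_right ((k ∙ z).neg_mem (mem_span_singleton_self _)))

theorem line_s_le_S : line k .s ≤ S k := le_sup_of_le_left (le_sup_of_le_left le_sup_right)

theorem line_t_le_S : line k .t ≤ S k := le_sup_of_le_left le_sup_right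

theorem line_s_mul_line_t_le_S : line k .s * line k .t ≤ S k := le_sup_right

theorem one_le_S : 1 ≤ S k := le_sup_of_le_left (le_sup_of_le_left le_sup_left)

theorem P_le_N : P k ≤ N k := le_sup_left

theorem Q_le_N : Q k ≤ N k := le_sup_right

theorem line_e_mul_R_le : line k .e * R k ≤ S k * (line k .e * N k) := by
  have h : line k .e * R k ≤ line k .s * (line k .e * Q k) ⊔ line k .t * (line k .e * P k) := by
    have h := sandwich_preprojective k 1 (gen k .e)
    simp only [gen_fe, mul_zero, add_zero, one_mul] at h
    simp only [P, Q, R, line, span_singleton_mul_span_singleton, mul_assoc]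
    exact span_singleton_le_sup_of_add_eq_zero h
  refine h.trans (sup_le ?_ ?_)
  · gcongr
    exacts [line_s_le_S k, Q_le_N k]
  · gcongr
    exacts [line_t_le_S k, P_le_N k]

theorem R_mul_line_f_le : R k * line k .f ≤
    P k * (line k .f * line k .t) ⊔ Q k * (line k .f * line k .s) := by
  have h := sandwich_preprojective k (gen k .f) 1
  simp only [gen_fe_assoc, zero_add, mul_one] at h
  simp only [P, Q, R, line, span_singleton_mul_span_singleton, mul_assoc]
  exact span_singleton_le_sup_of_add_eq_zero (by rw [← h]; abel)

theorem Q_mul_line_f_mul_line_s_le : Q k * (line k .f * line k .s) ≤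
    P k * (line k .f * line k .t) ⊔ R k * line k .f := by
  have h := sandwich_preprojective k (gen k .f) 1
  simp only [gen_fe_assoc, zero_add, mul_one] at h
  simp only [P, Q, R, line, span_singleton_mul_span_singleton, mul_assoc]
  exact span_singleton_le_sup_of_add_eq_zero (by rw [← h]; abel)

theorem R_mul_fs_eq : R k * (line k .f * line k .s) =
    P k * (line k .f * (line k .s * line k .t)) := by
  have h := sandwich_preprojective k (gen k .f * gen k .s) 1
  simp only [gen_ss_assoc, mul_zero, add_zero, mul_assoc, mul_one] at h
  simp only [P, R, line, span_singleton_mul_span_singleton, mul_assoc]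
  exact le_antisymm (span_singleton_le_of_eq_neg (by rw [eq_neg_iff_add_eq_zero, add_comm, h]))
    (span_singleton_le_of_eq_neg (by rw [eq_neg_iff_add_eq_zero, h]))

theorem R_mul_ft_eq : R k * (line k .f * line k .t) =
    Q k * (line k .f * (line k .s * line k .t)) := by
  have h := sandwich_preprojective k (gen k .f * gen k .t) 1
  simp only [gen_tt_assoc, gen_ts_assoc, mul_zero, add_zero, mul_assoc, mul_one] at h
  simp only [Q, R, line, span_singleton_mul_span_singleton, mul_assoc]
  exact le_antisymm (span_singleton_le_of_eq_neg (by rw [eq_neg_iff_add_eq_zero, add_comm, h]))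
    (span_singleton_le_of_eq_neg (by rw [eq_neg_iff_add_eq_zero, h]))

theorem R_mul_fst_eq_bot : R k * (line k .f * (line k .s * line k .t)) = ⊥ := by
  have h := sandwich_preprojective k (gen k .f * gen k .s * gen k .t) 1
  simp only [gen_tt_assoc, gen_ss_assoc, gen_ts_assoc, mul_zero, add_zero, mul_assoc,
    mul_one] at h
  simp only [R, line, span_singleton_mul_span_singleton, mul_assoc, h, span_zero_singleton]

/-! ### A spanning family in each degree -/

/-- The span of `f`, `fs`, `ft`, `fst`. -/
def fS : Submodule k (Pi5 k) := line k .f * S k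

theorem S_mul_S_le : S k * S k ≤ S k := by
  have hs : line k .s * line k .s = ⊥ := by
    simp [line, span_singleton_mul_span_singleton, gen_ss]
  have ht : line k .t * line k .t = ⊥ := by
    simp [line, span_singleton_mul_span_singleton, gen_tt]
  have hts : line k .t * line k .s = line k .s * line k .t := by
    simp [line, span_singleton_mul_span_singleton, gen_ts]
  have hs' (X : Submodule k (Pi5 k)) : line k .s * (line k .s * X) = ⊥ := by
    rw [← mul_assoc, hs, Submodule.bot_mul]
  have hts' (X : Submodule k (Pi5 k)) :
      line k .t * (line k .s * X) = line k .s * (line k .t * X) := by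
    rw [← mul_assoc, hts, mul_assoc]
  simp only [S, Submodule.sup_mul, Submodule.mul_sup, hs, ht, hts, hs', hts', mul_assoc, one_mul,
    mul_one, Submodule.mul_bot, sup_le_iff, bot_le, le_refl, and_true, true_and, le_sup_right]
  simp only [le_sup_of_le_left, le_sup_right, and_true]

theorem N_pow_succ (m : ℕ) : N k ^ (m + 1) = P k ^ (m + 1) ⊔ N k ^ m * Q k := by
  induction m with
  | zero => simp [N]
  | succ m ih =>
    have hQ : Commute (Q k) (P k) := Q_mul_P k
    apply le_antisymm
    · rw [pow_succ' (N k) (m + 1)]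
      conv_lhs => rw [ih, Submodule.mul_sup, ← mul_assoc, ← pow_succ']
      refine sup_le ?_ le_sup_right
      conv_lhs => rw [N, Submodule.sup_mul, (hQ.pow_right (m + 1)).eq, ← pow_succ']
      gcongr
      exact P_le_N k
    · refine sup_le (pow_le_pow_left' (P_le_N k) _) ?_
      rw [pow_succ (N k) (m + 1)]
      gcongr
      exact Q_le_N k

theorem R_mul_fS_le : R k * fS k ≤ N k * fS k := by
  have h1 : R k * (line k .f * 1) ≤ N k * fS k := by
    rw [mul_one]
    refine (R_mul_line_f_le k).trans (sup_le ?_ ?_)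
    · exact mul_le_mul' (P_le_N k) (mul_le_mul' le_rfl (line_t_le_S k))
    · exact mul_le_mul' (Q_le_N k) (mul_le_mul' le_rfl (line_s_le_S k))
  conv_lhs => rw [fS, S]
  simp only [Submodule.mul_sup, R_mul_fs_eq, R_mul_ft_eq, R_mul_fst_eq_bot]
  refine sup_le (sup_le (sup_le h1 ?_) ?_) bot_le
  · exact mul_le_mul' (P_le_N k) (mul_le_mul' le_rfl (line_s_mul_line_t_le_S k))
  · exact mul_le_mul' (Q_le_N k) (mul_le_mul' le_rfl (line_s_mul_line_t_le_S k))

theorem f_mul_S_mul_e_le : line k .f * (S k * line k .e) ≤ N k ⊔ R k := by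
  have hfe : line k .f * line k .e = ⊥ := by
    simp [line, span_singleton_mul_span_singleton, gen_fe]
  simp only [S, N, P, Q, R, Submodule.mul_sup, Submodule.sup_mul, one_mul, hfe, mul_assoc,
    bot_sup_eq, le_refl]

/-- Words from the `a`-vertex to itself with `2 * m` letters `e`, `f`. -/
def aaComp : ℕ → Submodule k (Pi5 k)
  | 0 => line k .a
  | m + 1 => N k ^ (m + 1) ⊔ N k ^ m * R k

/-- Words with `2 * m + 1` letters `e`, `f` starting with `f`. -/
def abComp (m : ℕ) : Submodule k (Pi5 k) := N k ^ m * fS k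

/-- Words with `2 * m + 1` letters `e`, `f` ending with `e`. -/
def baComp (m : ℕ) : Submodule k (Pi5 k) := S k * (line k .e * N k ^ m)

/-- The generators of `bbComp` as a left `S`-module. -/
def bbGen : ℕ → Submodule k (Pi5 k)
  | 0 => k ∙ (1 - gen k .a)
  | m + 1 => line k .e * (N k ^ m * line k .f) ⊔ line k .e * (N k ^ m * (line k .f * line k .t)) ⊔
      line k .e * (P k ^ m * (line k .f * line k .s))

/-- Words from the `S`-vertex to itself with `2 * m` letters `e`, `f`. -/
def bbComp (m : ℕ) : Submodule k (Pi5 k) := S k * bbGen k m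

theorem S_mul_bbComp_le (m : ℕ) : S k * bbComp k m ≤ bbComp k m := by
  rw [bbComp, ← mul_assoc]
  gcongr
  exact S_mul_S_le k

theorem S_mul_baComp_le (m : ℕ) : S k * baComp k m ≤ baComp k m := by
  rw [baComp, ← mul_assoc]
  gcongr
  exact S_mul_S_le k

theorem bbGen_le_bbComp (m : ℕ) : bbGen k m ≤ bbComp k m := by
  conv_lhs => rw [← one_mul (bbGen k m)]
  exact mul_le_mul' (one_le_S k) le_rfl

theorem e_N_pow_f_le (m : ℕ) : line k .e * (N k ^ m * line k .f) ≤ bbComp k (m + 1) :=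
  (le_sup_of_le_left le_sup_left).trans (bbGen_le_bbComp k (m + 1))

theorem e_N_pow_ft_le (m : ℕ) :
    line k .e * (N k ^ m * (line k .f * line k .t)) ≤ bbComp k (m + 1) :=
  (le_sup_of_le_left le_sup_right).trans (bbGen_le_bbComp k (m + 1))

/-- Moving `R` to the left across `N ^ m` and absorbing it into `e`. -/
theorem e_N_pow_R_le (m : ℕ) (X : Submodule k (Pi5 k)) :
    line k .e * (N k ^ m * (R k * X)) ≤ S k * (line k .e * (N k ^ (m + 1) * X)) := by
  calc line k .e * (N k ^ m * (R k * X)) = (line k .e * R k) * (N k ^ m * X) := by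
        rw [← mul_assoc (N k ^ m), ((commute_N_R k).pow_left m).eq]; simp only [mul_assoc]
    _ ≤ (S k * (line k .e * N k)) * (N k ^ m * X) := by
        exact mul_le_mul' (line_e_mul_R_le k) le_rfl
    _ = _ := by rw [pow_succ']; simp only [mul_assoc]

theorem e_N_pow_fs_le (m : ℕ) :
    line k .e * (N k ^ m * (line k .f * line k .s)) ≤ bbComp k (m + 1) := by
  cases m with
  | zero =>
    simpa [bbGen] using (le_sup_right (a := line k .e * (N k ^ 0 * line k .f) ⊔
      line k .e * (N k ^ 0 * (line k .f * line k .t)))).trans (bbGen_le_bbComp k 1)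
  | succ m =>
    conv_lhs => rw [N_pow_succ, Submodule.sup_mul, Submodule.mul_sup]
    refine sup_le (le_sup_right.trans (bbGen_le_bbComp k (m + 2))) ?_
    calc line k .e * (N k ^ m * Q k * (line k .f * line k .s))
        ≤ line k .e * (N k ^ m * (P k * (line k .f * line k .t) ⊔ R k * line k .f)) := by
          rw [mul_assoc (N k ^ m)]
          gcongr
          exact Q_mul_line_f_mul_line_s_le k
      _ = line k .e * (N k ^ m * P k * (line k .f * line k .t)) ⊔
          line k .e * (N k ^ m * (R k * line k .f)) := by
          simp only [Submodule.mul_sup, mul_assoc]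
      _ ≤ bbComp k (m + 2) := by
          refine sup_le (le_trans ?_ (e_N_pow_ft_le k (m + 1))) ?_
          · rw [pow_succ]
            gcongr
            exact P_le_N k
          · refine (e_N_pow_R_le k m _).trans (le_trans ?_ (S_mul_bbComp_le k (m + 2)))
            gcongr
            exact e_N_pow_f_le k (m + 1)

theorem e_fst_le : line k .e * (line k .f * (line k .s * line k .t)) ≤ bbComp k 1 := by
  have h : line k .e * (line k .f * (line k .s * line k .t)) ≤
      line k .s * (line k .e * (line k .f * line k .t)) ⊔
      line k .t * (line k .e * (line k .f * line k .s)) ⊔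
      line k .s * line k .t * (line k .e * line k .f) := by
    simp only [line, span_singleton_mul_span_singleton, mul_assoc]
    rw [span_singleton_le_iff_mem, eq_sub_of_add_eq (eq_sub_of_add_eq
      (eq_neg_of_add_eq_zero_left (preprojective k)))]
    refine Submodule.sub_mem _ (Submodule.sub_mem _ (Submodule.neg_mem _ ?_) ?_) ?_
    · exact mem_sup_right (mem_span_singleton_self _)
    · exact mem_sup_left (mem_sup_right (mem_span_singleton_self _))
    · exact mem_sup_left (mem_sup_left (mem_span_singleton_self _))
  refine h.trans (le_trans (sup_le (sup_le ?_ ?_) ?_) (S_mul_bbComp_le k 1))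
  · exact mul_le_mul' (line_s_le_S k) (by simpa using e_N_pow_ft_le k 0)
  · exact mul_le_mul' (line_t_le_S k) (by simpa using e_N_pow_fs_le k 0)
  · exact mul_le_mul' (line_s_mul_line_t_le_S k) (by simpa using e_N_pow_f_le k 0)

theorem e_N_pow_fst_le (m : ℕ) :
    line k .e * (N k ^ m * (line k .f * (line k .s * line k .t))) ≤ bbComp k (m + 1) := by
  cases m with
  | zero => simpa using e_fst_le k
  | succ m =>
    calc line k .e * (N k ^ (m + 1) * (line k .f * (line k .s * line k .t)))
        = line k .e * (N k ^ m * (R k * (line k .f * line k .s))) ⊔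
          line k .e * (N k ^ m * (R k * (line k .f * line k .t))) := by
          rw [R_mul_fs_eq, R_mul_ft_eq, ← Submodule.mul_sup, ← Submodule.mul_sup,
            ← Submodule.sup_mul, pow_succ, mul_assoc (N k ^ m), N]
      _ ≤ bbComp k (m + 2) := by
          refine sup_le ?_ ?_ <;>
          refine (e_N_pow_R_le k m _).trans (le_trans ?_ (S_mul_bbComp_le k (m + 2))) <;>
          gcongr
          · exact e_N_pow_fs_le k (m + 1)
          · exact e_N_pow_ft_le k (m + 1)

theorem e_abComp_le (m : ℕ) : line k .e * abComp k m ≤ bbComp k (m + 1) := by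
  simp only [abComp, fS, S, Submodule.mul_sup, mul_one]
  exact sup_le (sup_le (sup_le (e_N_pow_f_le k m) (e_N_pow_fs_le k m)) (e_N_pow_ft_le k m))
    (e_N_pow_fst_le k m)

theorem a_mul_S : line k .a * S k = line k .a := by
  have hs : line k .a * line k .s = ⊥ := by
    simp [line, span_singleton_mul_span_singleton, gen_as]
  have ht : line k .a * line k .t = ⊥ := by
    simp [line, span_singleton_mul_span_singleton, gen_at]
  rw [S, Submodule.mul_sup, Submodule.mul_sup, Submodule.mul_sup, ← mul_assoc, hs, ht,
    Submodule.bot_mul, mul_one, sup_bot_eq, sup_bot_eq, sup_bot_eq]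

theorem a_mul_f : line k .a * line k .f = line k .f := by
  simp [line, span_singleton_mul_span_singleton, gen_af]

theorem a_mul_e : line k .a * line k .e = ⊥ := by
  simp [line, span_singleton_mul_span_singleton, gen_ae]

theorem e_mul_a : line k .e * line k .a = line k .e := by
  simp [line, span_singleton_mul_span_singleton, gen_ea]

theorem a_mul_N : line k .a * N k = N k := by
  simp only [N, P, Q, Submodule.mul_sup, ← mul_assoc, a_mul_f]

theorem a_mul_R : line k .a * R k = R k := by
  simp only [R, ← mul_assoc, a_mul_f]

theorem a_mul_N_pow_mul {X : Submodule k (Pi5 k)} (h : line k .a * X = X) (m : ℕ) :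
    line k .a * (N k ^ m * X) = N k ^ m * X := by
  cases m with
  | zero => simpa using h
  | succ m => rw [← mul_assoc, pow_succ', ← mul_assoc, a_mul_N]

theorem a_mul_aaComp (m : ℕ) : line k .a * aaComp k m = aaComp k m := by
  cases m with
  | zero => simp [aaComp, line, span_singleton_mul_span_singleton, gen_aa]
  | succ m =>
    rw [aaComp, Submodule.mul_sup, a_mul_N_pow_mul k (a_mul_R k), pow_succ,
      a_mul_N_pow_mul k (a_mul_N k)]

theorem a_mul_abComp (m : ℕ) : line k .a * abComp k m = abComp k m :=
  a_mul_N_pow_mul k (by rw [fS, ← mul_assoc, a_mul_f]) m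

theorem a_mul_baComp (m : ℕ) : line k .a * baComp k m = ⊥ := by
  rw [baComp, ← mul_assoc, a_mul_S, ← mul_assoc, a_mul_e, Submodule.bot_mul]

theorem a_mul_bbComp (m : ℕ) : line k .a * bbComp k m = ⊥ := by
  rw [bbComp, ← mul_assoc, a_mul_S]
  cases m with
  | zero => simp [bbGen, line, span_singleton_mul_span_singleton, mul_sub, gen_aa]
  | succ m =>
    simp only [bbGen, Submodule.mul_sup, ← mul_assoc, a_mul_e, Submodule.bot_mul, sup_bot_eq]

/-- A letter that kills `a` on the right kills every subspace fixed by `a` on the left. -/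
theorem line_mul_eq_bot {x : Gen5} (hx : gen k x * gen k .a = 0) {X : Submodule k (Pi5 k)}
    (hX : line k .a * X = X) : line k x * X = ⊥ := by
  have hxa : line k x * line k .a = ⊥ := by
    simp [line, span_singleton_mul_span_singleton, hx]
  rw [← hX, ← mul_assoc, hxa, Submodule.bot_mul]

theorem e_mul_eq_bot {X : Submodule k (Pi5 k)} (hX : line k .a * X = ⊥) :
    line k .e * X = ⊥ := by
  rw [← e_mul_a, mul_assoc, hX, Submodule.mul_bot]

theorem e_mul_aaComp_le (m : ℕ) : line k .e * aaComp k m ≤ baComp k m := by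
  have hS (X : Submodule k (Pi5 k)) : X ≤ S k * X := by
    conv_lhs => rw [← one_mul X]
    exact mul_le_mul' (one_le_S k) le_rfl
  cases m with
  | zero => simpa [aaComp, baComp, e_mul_a] using hS (line k .e)
  | succ m =>
    rw [aaComp, Submodule.mul_sup]
    exact sup_le (hS _) (by simpa [baComp] using e_N_pow_R_le k m 1)

theorem f_mul_baComp_le (m : ℕ) : line k .f * baComp k m ≤ aaComp k (m + 1) := by
  calc line k .f * baComp k m = line k .f * (S k * line k .e) * N k ^ m := by
        simp only [baComp, mul_assoc]
    _ ≤ (N k ⊔ R k) * N k ^ m := mul_le_mul' (f_mul_S_mul_e_le k) le_rfl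
    _ = aaComp k (m + 1) := by
        rw [Submodule.sup_mul, ← pow_succ', ((commute_N_R k).pow_left m).eq.symm, aaComp]

theorem bbGen_succ_le (m : ℕ) : bbGen k (m + 1) ≤ line k .e * (N k ^ m * fS k) := by
  have h1 : line k .f ≤ fS k := by
    conv_lhs => rw [← mul_one (line k .f)]
    exact mul_le_mul' le_rfl (one_le_S k)
  refine sup_le (sup_le ?_ ?_) ?_
  · exact mul_le_mul' le_rfl (mul_le_mul' le_rfl h1)
  · exact mul_le_mul' le_rfl (mul_le_mul' le_rfl (mul_le_mul' le_rfl (line_t_le_S k)))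
  · exact mul_le_mul' le_rfl (mul_le_mul' (pow_le_pow_left' (P_le_N k) m)
      (mul_le_mul' le_rfl (line_s_le_S k)))

theorem f_mul_bbComp_le (m : ℕ) : line k .f * bbComp k m ≤ abComp k m := by
  cases m with
  | zero =>
    have hf : line k .f * (k ∙ (1 - gen k .a)) = line k .f := by
      simp [line, span_singleton_mul_span_singleton, mul_sub, gen_fa]
    have hs : line k .s * (k ∙ (1 - gen k .a)) = line k .s := by
      simp [line, span_singleton_mul_span_singleton, mul_sub, gen_sa]
    have ht : line k .t * (k ∙ (1 - gen k .a)) = line k .t := by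
      simp [line, span_singleton_mul_span_singleton, mul_sub, gen_ta]
    simp only [bbComp, abComp, fS, S, bbGen, Submodule.sup_mul, Submodule.mul_sup, one_mul,
      mul_one, mul_assoc, hf, hs, ht, pow_zero, le_refl]
  | succ m =>
    calc line k .f * bbComp k (m + 1)
        ≤ line k .f * (S k * (line k .e * (N k ^ m * fS k))) :=
          mul_le_mul' le_rfl (mul_le_mul' le_rfl (bbGen_succ_le k m))
      _ = line k .f * (S k * line k .e) * (N k ^ m * fS k) := by simp only [mul_assoc]
      _ ≤ (N k ⊔ R k) * (N k ^ m * fS k) := mul_le_mul' (f_mul_S_mul_e_le k) le_rfl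
      _ = N k ^ (m + 1) * fS k ⊔ N k ^ m * (R k * fS k) := by
          rw [Submodule.sup_mul, ← mul_assoc, ← pow_succ', ← mul_assoc,
            ((commute_N_R k).pow_left m).eq.symm, mul_assoc]
      _ ≤ N k ^ (m + 1) * fS k := by
          refine sup_le le_rfl ?_
          rw [pow_succ, mul_assoc]
          exact mul_le_mul' le_rfl (R_mul_fS_le k)

/-- The span of a family of words of degree `d` which turns out to be the whole component. -/
def normalComp (d : ℕ) : Submodule k (Pi5 k) :=
  if Even d then aaComp k (d / 2) ⊔ bbComp k (d / 2) else abComp k (d / 2) ⊔ baComp k (d / 2)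

theorem normalComp_two_mul (m : ℕ) : normalComp k (2 * m) = aaComp k m ⊔ bbComp k m := by
  simp [normalComp]

theorem normalComp_two_mul_add_one (m : ℕ) :
    normalComp k (2 * m + 1) = abComp k m ⊔ baComp k m := by
  simp [normalComp, Nat.mul_add_div]

theorem one_mem_normalComp : (1 : Pi5 k) ∈ normalComp k 0 := by
  rw [← mul_zero 2, normalComp_two_mul, ← add_sub_cancel (gen k .a) 1]
  exact Submodule.add_mem _ (mem_sup_left (mem_span_singleton_self _))
    (mem_sup_right (bbGen_le_bbComp k 0 (mem_span_singleton_self _)))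

theorem line_mul_normalComp_le (x : Gen5) (d : ℕ) :
    line k x * normalComp k d ≤ normalComp k (deg5 x + d) := by
  obtain ⟨m, rfl | rfl⟩ := d.even_or_odd'
  · cases x
    case e =>
      rw [deg5, add_comm, normalComp_two_mul_add_one, normalComp_two_mul, Submodule.mul_sup,
        e_mul_eq_bot k (a_mul_bbComp k m), sup_bot_eq]
      exact (e_mul_aaComp_le k m).trans le_sup_right
    case f =>
      rw [deg5, add_comm, normalComp_two_mul_add_one, normalComp_two_mul, Submodule.mul_sup,
        line_mul_eq_bot k (gen_fa k) (a_mul_aaComp k m), bot_sup_eq]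
      exact (f_mul_bbComp_le k m).trans le_sup_left
    all_goals rw [deg5, zero_add, normalComp_two_mul, Submodule.mul_sup]
    case a =>
      rw [a_mul_aaComp, a_mul_bbComp]
      exact sup_le_sup le_rfl bot_le
    case s =>
      rw [line_mul_eq_bot k (gen_sa k) (a_mul_aaComp k m)]
      exact sup_le_sup bot_le ((mul_le_mul' (line_s_le_S k) le_rfl).trans (S_mul_bbComp_le k m))
    case t =>
      rw [line_mul_eq_bot k (gen_ta k) (a_mul_aaComp k m)]
      exact sup_le_sup bot_le ((mul_le_mul' (line_t_le_S k) le_rfl).trans (S_mul_bbComp_le k m))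
  · cases x
    case e =>
      rw [deg5, show 1 + (2 * m + 1) = 2 * (m + 1) by ring, normalComp_two_mul_add_one,
        normalComp_two_mul, Submodule.mul_sup, e_mul_eq_bot k (a_mul_baComp k m), sup_bot_eq]
      exact (e_abComp_le k m).trans le_sup_right
    case f =>
      rw [deg5, show 1 + (2 * m + 1) = 2 * (m + 1) by ring, normalComp_two_mul_add_one,
        normalComp_two_mul, Submodule.mul_sup,
        line_mul_eq_bot k (gen_fa k) (a_mul_abComp k m), bot_sup_eq]
      exact (f_mul_baComp_le k m).trans le_sup_left
    all_goals rw [deg5, zero_add, normalComp_two_mul_add_one, Submodule.mul_sup]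
    case a =>
      rw [a_mul_abComp, a_mul_baComp]
      exact sup_le_sup le_rfl bot_le
    case s =>
      rw [line_mul_eq_bot k (gen_sa k) (a_mul_abComp k m)]
      exact sup_le_sup bot_le ((mul_le_mul' (line_s_le_S k) le_rfl).trans (S_mul_baComp_le k m))
    case t =>
      rw [line_mul_eq_bot k (gen_ta k) (a_mul_abComp k m)]
      exact sup_le_sup bot_le ((mul_le_mul' (line_t_le_S k) le_rfl).trans (S_mul_baComp_le k m))

theorem prod_gen_mem_normalComp (l : List Gen5) :
    (l.map (gen k)).prod ∈ normalComp k (l.map deg5).sum := by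
  induction l with
  | nil => exact one_mem_normalComp k
  | cons x l ih =>
    exact line_mul_normalComp_le k x _ (mul_mem_mul (mem_span_singleton_self _) ih)

theorem Pi5Comp_le_normalComp (d : ℕ) : Pi5Comp k d ≤ normalComp k d := by
  rw [Pi5Comp, span_le]
  rintro _ ⟨l, rfl, rfl⟩
  exact prod_gen_mem_normalComp k l

/-! ### Dimension bounds -/

section Rank

variable {k} {A : Type} [Ring A] [Algebra k A] {X Y : Submodule k A} {m n : ℕ}

theorem rank_sup_le (hX : Module.rank k X ≤ m) (hY : Module.rank k Y ≤ n) :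
    Module.rank k ↥(X ⊔ Y) ≤ (m + n : ℕ) := by
  rw [Nat.cast_add]
  exact (Submodule.rank_add_le_rank_add_rank X Y).trans (add_le_add hX hY)

theorem rank_mul_le (hX : Module.rank k X ≤ m) (hY : Module.rank k Y ≤ n) :
    Module.rank k ↥(X * Y) ≤ (m * n : ℕ) := by
  rw [← mulMap_range, Nat.cast_mul]
  refine (rank_range_le _).trans ?_
  rw [rank_tensorProduct']
  exact mul_le_mul' hX hY

theorem rank_span_singleton_le (x : A) : Module.rank k (k ∙ x) ≤ (1 : ℕ) := by
  simpa using rank_span_le (R := k) {x}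

end Rank

theorem rank_line_le (x : Gen5) : Module.rank k (line k x) ≤ (1 : ℕ) := rank_span_singleton_le _

theorem rank_S_le : Module.rank k (S k) ≤ (4 : ℕ) := by
  have h1 : Module.rank k (1 : Submodule k (Pi5 k)) ≤ (1 : ℕ) := by
    rw [one_eq_span_singleton]
    exact rank_span_singleton_le _
  exact rank_sup_le (rank_sup_le (rank_sup_le h1 (rank_line_le k .s)) (rank_line_le k .t))
    (rank_mul_le (rank_line_le k .s) (rank_line_le k .t))

theorem rank_P_pow_le (m : ℕ) : Module.rank k ↥(P k ^ m) ≤ (1 : ℕ) := by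
  induction m with
  | zero =>
    rw [pow_zero, one_eq_span_singleton]
    exact rank_span_singleton_le _
  | succ m ih =>
    rw [pow_succ]
    exact rank_mul_le ih (rank_mul_le (rank_mul_le (rank_line_le k .f) (rank_line_le k .s))
      (rank_line_le k .e))

theorem rank_N_pow_le (m : ℕ) : Module.rank k ↥(N k ^ m) ≤ (m + 1 : ℕ) := by
  induction m with
  | zero => exact rank_P_pow_le k 0
  | succ m ih =>
    rw [N_pow_succ, add_comm (m + 1) 1, ← mul_one (m + 1)]
    exact rank_sup_le (rank_P_pow_le k _) (rank_mul_le ih (rank_mul_le (rank_mul_le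
      (rank_line_le k .f) (rank_line_le k .t)) (rank_line_le k .e)))

theorem rank_R_le : Module.rank k (R k) ≤ (1 : ℕ) :=
  rank_mul_le (rank_mul_le (rank_mul_le (rank_line_le k .f) (rank_line_le k .s))
    (rank_line_le k .t)) (rank_line_le k .e)

theorem rank_aaComp_le (m : ℕ) : Module.rank k (aaComp k m) ≤ (2 * m + 1 : ℕ) := by
  cases m with
  | zero => exact rank_line_le k .a
  | succ m =>
    rw [show 2 * (m + 1) + 1 = m + 1 + 1 + (m + 1) * 1 by ring]
    exact rank_sup_le (rank_N_pow_le k (m + 1)) (rank_mul_le (rank_N_pow_le k m) (rank_R_le k))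

theorem rank_bbComp_le (m : ℕ) : Module.rank k (bbComp k m) ≤ (4 * (2 * m + 1) : ℕ) := by
  refine rank_mul_le (rank_S_le k) ?_
  cases m with
  | zero => exact rank_span_singleton_le _
  | succ m =>
    rw [show 2 * (m + 1) + 1 = 1 * ((m + 1) * 1) + 1 * ((m + 1) * (1 * 1)) + 1 * (1 * (1 * 1)) by
      ring]
    have he := rank_line_le k .e
    have hf := rank_line_le k .f
    exact rank_sup_le (rank_sup_le (rank_mul_le he (rank_mul_le (rank_N_pow_le k m) hf))
      (rank_mul_le he (rank_mul_le (rank_N_pow_le k m) (rank_mul_le hf (rank_line_le k .t)))))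
      (rank_mul_le he (rank_mul_le (rank_P_pow_le k m) (rank_mul_le hf (rank_line_le k .s))))

theorem rank_abComp_le (m : ℕ) : Module.rank k (abComp k m) ≤ ((m + 1) * (1 * 4) : ℕ) :=
  rank_mul_le (rank_N_pow_le k m) (rank_mul_le (rank_line_le k .f) (rank_S_le k))

theorem rank_baComp_le (m : ℕ) : Module.rank k (baComp k m) ≤ (4 * (1 * (m + 1)) : ℕ) :=
  rank_mul_le (rank_S_le k) (rank_mul_le (rank_line_le k .e) (rank_N_pow_le k m))

theorem rank_normalComp_le (d : ℕ) :
    Module.rank k (normalComp k d) ≤ (if Even d then 5 * (d + 1) else 4 * (d + 1) : ℕ) := by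
  obtain ⟨m, rfl | rfl⟩ := d.even_or_odd'
  · rw [if_pos (even_two_mul m), normalComp_two_mul,
      show 5 * (2 * m + 1) = 2 * m + 1 + 4 * (2 * m + 1) by ring]
    exact rank_sup_le (rank_aaComp_le k m) (rank_bbComp_le k m)
  · rw [if_neg (Nat.not_even_two_mul_add_one m), normalComp_two_mul_add_one,
      show 4 * (2 * m + 1 + 1) = (m + 1) * (1 * 4) + 4 * (1 * (m + 1)) by ring]
    exact rank_sup_le (rank_abComp_le k m) (rank_baComp_le k m)

end Pi5

/-- The degree-`d` component of `Π_k(k[s,t]/(s²,t²))` has dimension at most `5(d+1)` if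
`d` is even and at most `4(d+1)` if `d` is odd. -/
theorem pi5_dim_le (d : ℕ) :
    Module.rank k (Pi5Comp k d) ≤
      ((if Even d then 5 * (d + 1) else 4 * (d + 1) : ℕ) : Cardinal) := by
  exact (Submodule.rank_mono (Pi5.Pi5Comp_le_normalComp k d)).trans (Pi5.rank_normalComp_le k d)

end
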